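/- Let a linear pentapod design have a planar base, not be architecturally singular, and have det S linear in the orientation variables. Then one of the following three cases holds: (1) the base points M_2, M_3, M_4, M_5 are collinear; (2) there exists i ∈ {2,…,5} with r_i = 0 (i.e., m_1 = m_i) and the three base points M_j, M_k, M_l with {j,k,l} = {2,…,5}\{i} are collinear; (3) there exist distinct i, j ∈ {2,…,5} with r_i = r_j = 0 (i.e., m_1 = m_i = m_j). -/

import Mathlib

open Matrix

/-- The 7×7 matrix `S` of a linear pentapod design with platform parameters
`r` and base coordinates `x`, `y`, `z` (indices `1,…,4` of `Fin 5` correspond to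
legs `2,…,5`; index `0` corresponds to leg `1`), at pose `(u,v,w,px,py,pz)`. -/
noncomputable def Smat (r x y z : Fin 5 → ℝ) (u v w px py pz : ℝ) :
    Matrix (Fin 7) (Fin 7) ℝ :=
  !![(1 : ℝ), u, v, w, px, py, pz;
     0, px, py, pz, 0, 0, 0;
     0, 0, 0, 0, u, v, w;
     r 1, x 1, y 1, z 1, r 1 * x 1, r 1 * y 1, r 1 * z 1;
     r 2, x 2, y 2, z 2, r 2 * x 2, r 2 * y 2, r 2 * z 2;
     r 3, x 3, y 3, z 3, r 3 * x 3, r 3 * y 3, r 3 * z 3;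
     r 4, x 4, y 4, z 4, r 4 * x 4, r 4 * y 4, r 4 * z 4]

/-- The 4×7 architecture matrix of the design. -/
noncomputable def archMat (r x y z : Fin 5 → ℝ) : Matrix (Fin 4) (Fin 7) ℝ :=
  !![r 1, x 1, y 1, z 1, r 1 * x 1, r 1 * y 1, r 1 * z 1;
     r 2, x 2, y 2, z 2, r 2 * x 2, r 2 * y 2, r 2 * z 2;
     r 3, x 3, y 3, z 3, r 3 * x 3, r 3 * y 3, r 3 * z 3;
     r 4, x 4, y 4, z 4, r 4 * x 4, r 4 * y 4, r 4 * z 4]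

/-- The design is architecturally singular: the singularity polynomial `det S`
vanishes at every pose on the quadric `u² + v² + w² = 1`. -/
def ArchSingular (r x y z : Fin 5 → ℝ) : Prop :=
  ∀ u v w px py pz : ℝ, u ^ 2 + v ^ 2 + w ^ 2 = 1 →
    (Smat r x y z u v w px py pz).det = 0

/-- The bracket `[A₁, A₂, A₃, A₄]`: the determinant of the 4×4 matrix with
columns `A₁, A₂, A₃, A₄`. -/
noncomputable def bracket (A1 A2 A3 A4 : Fin 4 → ℝ) : ℝ :=
  (Matrix.of fun i j => ![A1, A2, A3, A4] j i).det

/-- The vector in `ℝ⁴` formed by the values of `f` at legs `2,…,5`. -/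
def colVec (f : Fin 5 → ℝ) : Fin 4 → ℝ := fun i => f i.succ

/-- The componentwise product vector (e.g. `rX`, `rY`, `rZ`) for legs `2,…,5`. -/
def colProd (r f : Fin 5 → ℝ) : Fin 4 → ℝ := fun i => r i.succ * f i.succ

/-- The base anchor point `M_j = (x_j, y_j, z_j) ∈ ℝ³`. -/
def Mpt (x y z : Fin 5 → ℝ) (j : Fin 5) : Fin 3 → ℝ := ![x j, y j, z j]

theorem det_cons_row_eq_bracket (a b c d e : ℝ) (A B C D E : Fin 4 → ℝ) :
    !![a, b, c, d, e;
       A 0, B 0, C 0, D 0, E 0;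
       A 1, B 1, C 1, D 1, E 1;
       A 2, B 2, C 2, D 2, E 2;
       A 3, B 3, C 3, D 3, E 3].det =
      a * bracket B C D E - b * bracket A C D E + c * bracket A B D E -
        d * bracket A B C E + e * bracket A B C D := by
  have bracket_of_rows (M : Matrix (Fin 4) (Fin 4) ℝ) (P Q R S : Fin 4 → ℝ)
      (hM : ∀ i, M i = ![P i, Q i, R i, S i]) : M.det = bracket P Q R S := by
    unfold bracket
    congr 1
    ext i j
    rw [hM i]
    fin_cases j <;> rfl
  rw [det_succ_row_zero, Fin.sum_univ_five, bracket_of_rows _ B C D E,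
    bracket_of_rows _ A C D E, bracket_of_rows _ A B D E, bracket_of_rows _ A B C E,
    bracket_of_rows _ A B C D]
  · simp
    ring
  all_goals
    intro i
    ext j
    fin_cases i <;> fin_cases j <;> rfl

theorem det_cons_two_rows_eq_bracket (a b c d e f a' b' c' d' e' f' : ℝ)
    (A B C D E : Fin 4 → ℝ) :
    !![a, b, c, d, e, f;
       a', b', c', d', e', f';
       A 0, B 0, C 0, D 0, E 0, 0;
       A 1, B 1, C 1, D 1, E 1, 0;
       A 2, B 2, C 2, D 2, E 2, 0;
       A 3, B 3, C 3, D 3, E 3, 0].det =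
      f' * (a * bracket B C D E - b * bracket A C D E + c * bracket A B D E -
        d * bracket A B C E + e * bracket A B C D) -
      f * (a' * bracket B C D E - b' * bracket A C D E + c' * bracket A B D E -
        d' * bracket A B C E + e' * bracket A B C D) := by
  have h := det_cons_row_eq_bracket a b c d e A B C D E
  have h' := det_cons_row_eq_bracket a' b' c' d' e' A B C D E
  rw [det_succ_column _ 5, Fin.sum_univ_succ, Fin.sum_univ_succ, Finset.sum_eq_zero]
  · refine (congrArg₂ (· + ·) (congrArg₂ (· * ·) (?_ : _ = -f) (Eq.trans ?_ h'))
      (congrArg (· + 0) (congrArg₂ (· * ·) (?_ : _ = f') (Eq.trans ?_ h)))).trans (by ring)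
    · simp
      norm_num
    · congr 1
      ext i j
      fin_cases i <;> fin_cases j <;> rfl
    · simp
      norm_num
    · congr 1
      ext i j
      fin_cases i <;> fin_cases j <;> rfl
  · intro i _
    fin_cases i <;> simp

theorem det_planar_eq_bracket (u v w p q s : ℝ) (A B C D E : Fin 4 → ℝ) :
    !![(1 : ℝ), u, v, w, p, q, s;
       0, p, q, s, 0, 0, 0;
       0, 0, 0, 0, u, v, w;
       A 0, B 0, C 0, 0, D 0, E 0, 0;
       A 1, B 1, C 1, 0, D 1, E 1, 0;
       A 2, B 2, C 2, 0, D 2, E 2, 0;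
       A 3, B 3, C 3, 0, D 3, E 3, 0].det =
      w ^ 2 * (p * bracket A C D E - q * bracket A B D E) +
      s * w * (bracket B C D E - u * bracket A C D E + v * bracket A B D E -
        p * bracket A B C E + q * bracket A B C D) +
      s ^ 2 * (u * bracket A B C E - v * bracket A B C D) := by
  have h := det_cons_two_rows_eq_bracket 0 p q 0 0 0 0 0 0 u v w A B C D E
  have h' := det_cons_two_rows_eq_bracket 1 u v p q s 0 0 0 u v w A B C D E
  rw [det_succ_column _ 3, Fin.sum_univ_succ, Fin.sum_univ_succ, Finset.sum_eq_zero]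
  · refine (congrArg₂ (· + ·) (congrArg₂ (· * ·) (?_ : _ = -w) (Eq.trans ?_ h))
      (congrArg (· + 0) (congrArg₂ (· * ·) (?_ : _ = s) (Eq.trans ?_ h')))).trans (by ring)
    · simp
      norm_num
    · congr 1
      ext i j
      fin_cases i <;> fin_cases j <;> rfl
    · simp
      norm_num
    · congr 1
      ext i j
      fin_cases i <;> fin_cases j <;> rfl
  · intro i _
    fin_cases i <;> simp

theorem bracket_mul_bracket_omit_first (a b c d e f : Fin 4 → ℝ) :
    bracket b c d e * bracket f a d e =
      bracket a c d e * bracket f b d e - bracket a b d e * bracket f c d e := by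
  simp [bracket, det_succ_row_zero, Fin.sum_univ_succ, Fin.succAbove]
  ring

theorem bracket_mul_bracket_omit_fourth (a b c d e f : Fin 4 → ℝ) :
    bracket a b c e * bracket f a d e =
      bracket a b d e * bracket f a c e - bracket a c d e * bracket f a b e := by
  simp [bracket, det_succ_row_zero, Fin.sum_univ_succ, Fin.succAbove]
  ring

theorem bracket_mul_bracket_omit_fifth (a b c d e f : Fin 4 → ℝ) :
    bracket a b c d * bracket f a d e =
      bracket a b d e * bracket f a c d - bracket a c d e * bracket f a b d := by
  simp [bracket, det_succ_row_zero, Fin.sum_univ_succ, Fin.succAbove]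
  ring

theorem det_Smat_of_planar {r x y z : Fin 5 → ℝ} (hz : ∀ j, z j = 0) (u v w p q s : ℝ) :
    (Smat r x y z u v w p q s).det =
      w ^ 2 * (p * bracket (colVec r) (colVec y) (colProd r x) (colProd r y) -
        q * bracket (colVec r) (colVec x) (colProd r x) (colProd r y)) +
      s * w * (bracket (colVec x) (colVec y) (colProd r x) (colProd r y) -
        u * bracket (colVec r) (colVec y) (colProd r x) (colProd r y) +
        v * bracket (colVec r) (colVec x) (colProd r x) (colProd r y) -
        p * bracket (colVec r) (colVec x) (colVec y) (colProd r y) +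
        q * bracket (colVec r) (colVec x) (colVec y) (colProd r x)) +
      s ^ 2 * (u * bracket (colVec r) (colVec x) (colVec y) (colProd r y) -
        v * bracket (colVec r) (colVec x) (colVec y) (colProd r x)) := by
  rw [← det_planar_eq_bracket, Smat]
  simp only [hz, mul_zero]
  rfl

/-- Twice the signed area of the triangle with vertices `(x j, y j)`, `(x k, y k)`, `(x l, y l)`. -/
def triangleDet (x y : Fin 5 → ℝ) (j k l : Fin 5) : ℝ :=
  (x k - x j) * (y l - y j) - (x l - x j) * (y k - y j)

theorem collinear_of_triangleDet_eq_zero_of_ne {x y z : Fin 5 → ℝ} (hz : ∀ j, z j = 0)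
    {j k : Fin 5} (hjk : Mpt x y z j ≠ Mpt x y z k) {t : Set (Fin 3 → ℝ)}
    (ht : ∀ p ∈ t, ∃ l, p = Mpt x y z l ∧ triangleDet x y j k l = 0) : Collinear ℝ t := by
  rw [collinear_iff_exists_forall_eq_smul_vadd]
  refine ⟨Mpt x y z j, Mpt x y z k - Mpt x y z j, fun p hp => ?_⟩
  obtain ⟨l, rfl, hl⟩ := ht p hp
  unfold triangleDet at hl
  by_cases hx : x k = x j
  · have hy : y k - y j ≠ 0 := fun h => hjk (by simp [Mpt, hz, hx, sub_eq_zero.1 h])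
    refine ⟨(y l - y j) / (y k - y j), ?_⟩
    have hxl : x l - x j = 0 := by
      rw [hx, sub_self, zero_mul, zero_sub, neg_eq_zero, mul_eq_zero] at hl
      exact hl.resolve_right hy
    ext i
    fin_cases i
    · simp [Mpt, hx, sub_eq_zero.1 hxl]
    · simp [Mpt, hy]
    · simp [Mpt, hz]
  · have hx' : x k - x j ≠ 0 := sub_ne_zero.2 hx
    refine ⟨(x l - x j) / (x k - x j), ?_⟩
    ext i
    fin_cases i
    · simp [Mpt, hx']
    · simp [Mpt]
      field_simp
      linear_combination hl
    · simp [Mpt, hz]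

theorem collinear_triple_of_triangleDet_eq_zero {x y z : Fin 5 → ℝ} (hz : ∀ j, z j = 0)
    {j k l : Fin 5} (h : triangleDet x y j k l = 0) :
    Collinear ℝ ({Mpt x y z j, Mpt x y z k, Mpt x y z l} : Set (Fin 3 → ℝ)) := by
  by_cases hjk : Mpt x y z j = Mpt x y z k
  · rw [hjk, Set.insert_eq_of_mem (Set.mem_insert _ _)]
    exact collinear_pair ℝ _ _
  · refine collinear_of_triangleDet_eq_zero_of_ne hz hjk ?_
    rintro p (rfl | rfl | rfl)
    · exact ⟨j, rfl, by simp [triangleDet]⟩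
    · exact ⟨k, rfl, by simp only [triangleDet]; ring⟩
    · exact ⟨l, rfl, h⟩

theorem collinear_quadruple_of_triangleDet_eq_zero {x y z : Fin 5 → ℝ} (hz : ∀ j, z j = 0)
    {i j k l : Fin 5} (hk : triangleDet x y i j k = 0) (hl : triangleDet x y i j l = 0)
    (hkl : triangleDet x y j k l = 0) :
    Collinear ℝ ({Mpt x y z i, Mpt x y z j, Mpt x y z k, Mpt x y z l} : Set (Fin 3 → ℝ)) := by
  by_cases hij : Mpt x y z i = Mpt x y z j
  · rw [hij, Set.insert_eq_of_mem (Set.mem_insert _ _)]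
    exact collinear_triple_of_triangleDet_eq_zero hz hkl
  · refine collinear_of_triangleDet_eq_zero_of_ne hz hij ?_
    rintro p (rfl | rfl | rfl | rfl)
    · exact ⟨i, rfl, by simp [triangleDet]⟩
    · exact ⟨j, rfl, by simp only [triangleDet]; ring⟩
    · exact ⟨k, rfl, hk⟩
    · exact ⟨l, rfl, hl⟩

theorem mul_triangleDet_eq_zero_of_bracket_eq_zero {r x y : Fin 5 → ℝ}
    (h : ∀ f, bracket f (colVec r) (colProd r x) (colProd r y) = 0) :
    r 2 * r 3 * r 4 * triangleDet x y 2 3 4 = 0 ∧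
      r 1 * r 3 * r 4 * triangleDet x y 1 3 4 = 0 ∧
      r 1 * r 2 * r 4 * triangleDet x y 1 2 4 = 0 ∧
      r 1 * r 2 * r 3 * triangleDet x y 1 2 3 = 0 := by
  have h0 := h ![1, 0, 0, 0]
  have h1 := h ![0, 1, 0, 0]
  have h2 := h ![0, 0, 1, 0]
  have h3 := h ![0, 0, 0, 1]
  simp [bracket, det_succ_row_zero, Fin.sum_univ_succ, Fin.succAbove, colVec, colProd]
    at h0 h1 h2 h3
  simp only [triangleDet]
  refine ⟨?_, ?_, ?_, ?_⟩
  · linear_combination h0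
  · linear_combination -h1
  · linear_combination h2
  · linear_combination -h3

theorem eq_zero_of_sq_mul_eq_affine {b c k : ℝ} (h : ∀ w : ℝ, w ^ 2 * k = b * w + c) :
    k = 0 := by
  linarith [h 0, h 1, h (-1)]

theorem stmt5 (r x y z : Fin 5 → ℝ)
    (hr1 : r 0 = 0) (hx1 : x 0 = 0) (hy1 : y 0 = 0) (hz1 : z 0 = 0)
    (hplanar : ∀ j, z j = 0)
    (hns : ¬ ArchSingular r x y z)
    (hlin : ∀ px py pz : ℝ, ∃ a b c d : ℝ, ∀ u v w : ℝ,
        (Smat r x y z u v w px py pz).det = a * u + b * v + c * w + d) :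
    Collinear ℝ
        ({Mpt x y z 1, Mpt x y z 2, Mpt x y z 3, Mpt x y z 4} : Set (Fin 3 → ℝ)) ∨
      (∃ i j k l : Fin 5, ({i, j, k, l} : Set (Fin 5)) = {1, 2, 3, 4} ∧ r i = 0 ∧
        Collinear ℝ ({Mpt x y z j, Mpt x y z k, Mpt x y z l} : Set (Fin 3 → ℝ))) ∨
      (∃ i j : Fin 5, i ≠ 0 ∧ j ≠ 0 ∧ i ≠ j ∧ r i = 0 ∧ r j = 0) := by
  have hY : bracket (colVec r) (colVec y) (colProd r x) (colProd r y) = 0 := by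
    obtain ⟨a, b, c, d, h⟩ := hlin 1 0 0
    refine eq_zero_of_sq_mul_eq_affine (b := c) (c := d) fun w => ?_
    have := h 0 0 w
    rw [det_Smat_of_planar hplanar] at this
    linear_combination this
  have hX : bracket (colVec r) (colVec x) (colProd r x) (colProd r y) = 0 := by
    obtain ⟨a, b, c, d, h⟩ := hlin 0 (-1) 0
    refine eq_zero_of_sq_mul_eq_affine (b := c) (c := d) fun w => ?_
    have := h 0 0 w
    rw [det_Smat_of_planar hplanar] at this
    linear_combination this
  have hdep (f : Fin 4 → ℝ) : bracket f (colVec r) (colProd r x) (colProd r y) = 0 := by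
    by_contra hf
    have h1 := bracket_mul_bracket_omit_first (colVec r) (colVec x) (colVec y)
      (colProd r x) (colProd r y) f
    have h4 := bracket_mul_bracket_omit_fourth (colVec r) (colVec x) (colVec y)
      (colProd r x) (colProd r y) f
    have h5 := bracket_mul_bracket_omit_fifth (colVec r) (colVec x) (colVec y)
      (colProd r x) (colProd r y) f
    simp only [hX, hY, zero_mul, sub_zero, mul_eq_zero, hf, or_false] at h1 h4 h5
    refine hns fun u v w p q s _ => ?_
    rw [det_Smat_of_planar hplanar, hX, hY, h1, h4, h5]
    ring
  obtain ⟨h234, h134, h124, h123⟩ := mul_triangleDet_eq_zero_of_bracket_eq_zero hdep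
  by_cases hr : ∃ i j : Fin 5, i ≠ 0 ∧ j ≠ 0 ∧ i ≠ j ∧ r i = 0 ∧ r j = 0
  · exact Or.inr (Or.inr hr)
  have hr' (i j : Fin 5) (hi : r i = 0) (hi0 : i ≠ 0 := by decide) (hj0 : j ≠ 0 := by decide)
      (hij : i ≠ j := by decide) : r j ≠ 0 := fun hj => hr ⟨i, j, hi0, hj0, hij, hi, hj⟩
  by_cases h1 : r 1 = 0
  · refine Or.inr (Or.inl ⟨1, 2, 3, 4, rfl, h1, collinear_triple_of_triangleDet_eq_zero hplanar ?_⟩)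
    simpa [hr' 1 2 h1, hr' 1 3 h1, hr' 1 4 h1] using h234
  by_cases h2 : r 2 = 0
  · refine Or.inr (Or.inl ⟨2, 1, 3, 4, by ext; simp; tauto, h2,
      collinear_triple_of_triangleDet_eq_zero hplanar ?_⟩)
    simpa [hr' 2 1 h2, hr' 2 3 h2, hr' 2 4 h2] using h134
  by_cases h3 : r 3 = 0
  · refine Or.inr (Or.inl ⟨3, 1, 2, 4, by ext; simp; tauto, h3,
      collinear_triple_of_triangleDet_eq_zero hplanar ?_⟩)
    simpa [hr' 3 1 h3, hr' 3 2 h3, hr' 3 4 h3] using h124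
  by_cases h4 : r 4 = 0
  · refine Or.inr (Or.inl ⟨4, 1, 2, 3, by ext; simp; tauto, h4,
      collinear_triple_of_triangleDet_eq_zero hplanar ?_⟩)
    simpa [hr' 4 1 h4, hr' 4 2 h4, hr' 4 3 h4] using h123
  simp only [mul_eq_zero, h1, h2, h3, h4, false_or] at h234 h124 h123
  exact Or.inl (collinear_quadruple_of_triangleDet_eq_zero hplanar h123 h124 h234)
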